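/- arXiv:1701.02622 — 4 statements merged into one kernel-verified Lean document; each statement's English description precedes it below -/
import Mathlib

section
/- Let A be a ℤ-graded associative ring, let δ ∈ A_m be homogeneous of odd degree m, and let φ ∈ A_i, ψ ∈ A_k be homogeneous. Then [[φ,δ],[ψ,δ]] − [[[φ,δ],ψ],δ] = −(−1)^k·[[φ,δ²],ψ], where [·,·] denotes the graded commutator (note δ² ∈ A_{2m} has even degree, so [φ,δ²] = φδ² − δ²φ). -/
/-- The graded commutator of two elements of degrees `i` and `j` in a ring:
`[a,b] = a*b - (-1)^(i*j) * (b*a)`. -/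
noncomputable def gradedComm {A : Type*} [Ring A] (i j : ℤ) (a b : A) : A :=
  a * b - ((Int.negOnePow (i * j) : ℤ) : A) * (b * a)

/-- Lemma 14 of the paper (ring-level form): for `δ` homogeneous of odd degree `m`,
`φ ∈ A_i`, `ψ ∈ A_k`, one has
`[[φ,δ],[ψ,δ]] - [[[φ,δ],ψ],δ] = -(-1)^k [[φ,δ²],ψ]`. -/
theorem stmt1 {A : Type*} [Ring A] (𝒜 : ℤ → AddSubgroup A) [GradedRing 𝒜]
    (m i k : ℤ) (hm : Odd m) (φ ψ δ : A)
    (hφ : φ ∈ 𝒜 i) (hψ : ψ ∈ 𝒜 k) (hδ : δ ∈ 𝒜 m) :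
    gradedComm (i + m) (k + m) (gradedComm i m φ δ) (gradedComm k m ψ δ) -
      gradedComm (i + m + k) m (gradedComm (i + m) k (gradedComm i m φ δ) ψ) δ =
    - (((Int.negOnePow k : ℤ) : A) *
        gradedComm (i + 2 * m) k (gradedComm i (2 * m) φ (δ * δ)) ψ) := by
  rcases Int.even_or_odd i with hi | hi <;> rcases Int.even_or_odd k with hk | hk <;>
    simp only [gradedComm, Int.negOnePow_add, Int.negOnePow_even, Int.negOnePow_odd, mul_add,
      add_mul, two_mul, hm, hi, hk, Even.mul_left, Even.mul_right, Odd.mul, Units.val_neg,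
      Units.val_one, Units.val_mul, Int.cast_neg, Int.cast_one, Int.cast_mul] <;>
    noncomm_ring
end

section
/- Let V be an n-dimensional real vector space, W = V × V* with the form ⟨(X,α),(Y,β)⟩ = α(Y) + β(X), and let E ⊆ W be split of rank 2k with orthogonal complement E^⊥. Then dim π(E) = k if and only if V* = (V* ∩ E) ⊕ (V* ∩ E^⊥) (an internal direct sum inside W, where V* is identified with {0} × V*). -/
open Module

/-- The tautological symmetric pairing on `W = V × V*`:
`⟨(X,α),(Y,β)⟩ = α(Y) + β(X)`. -/
noncomputable def pairingForm (V : Type*) [AddCommGroup V] [Module ℝ V] :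
    LinearMap.BilinForm ℝ (V × Module.Dual ℝ V) :=
  LinearMap.mk₂ ℝ (fun w w' => w.2 w'.1 + w'.2 w.1)
    (fun m₁ m₂ n => by simp; ring)
    (fun c m n => by simp [smul_add]; ring)
    (fun m n₁ n₂ => by simp; ring)
    (fun c m n => by simp [smul_add]; ring)

/-- A subspace `E ⊆ V × V*` is split of rank `2k` if it has dimension `2k` and the
restriction of the tautological pairing to it is nondegenerate of signature `(k,k)`,
i.e. nondegenerate and admitting a positive-definite subspace and a negative-definite
subspace each of dimension `k`. -/
def IsSplitOfRank {V : Type*} [AddCommGroup V] [Module ℝ V]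
    (k : ℕ) (E : Submodule ℝ (V × Module.Dual ℝ V)) : Prop :=
  Module.finrank ℝ E = 2 * k ∧
  (∀ x ∈ E, (∀ y ∈ E, pairingForm V x y = 0) → x = 0) ∧
  ∃ P N : Submodule ℝ (V × Module.Dual ℝ V), P ≤ E ∧ N ≤ E ∧
    Module.finrank ℝ P = k ∧ Module.finrank ℝ N = k ∧
    (∀ x ∈ P, x ≠ 0 → 0 < pairingForm V x x) ∧
    (∀ x ∈ N, x ≠ 0 → pairingForm V x x < 0)

/-- The copy of `V*` inside `W = V × V*`. -/
def cotSub (V : Type*) [AddCommGroup V] [Module ℝ V] :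
    Submodule ℝ (V × Module.Dual ℝ V) :=
  Submodule.prod ⊥ ⊤

/-- The projection `π : V × V* → V`. -/
noncomputable def projTan (V : Type*) [AddCommGroup V] [Module ℝ V] :
    (V × Module.Dual ℝ V) →ₗ[ℝ] V :=
  LinearMap.fst ℝ V (Module.Dual ℝ V)

@[simp]
theorem pairingForm_apply {V : Type*} [AddCommGroup V] [Module ℝ V]
    (w w' : V × Module.Dual ℝ V) : pairingForm V w w' = w.2 w'.1 + w'.2 w.1 :=
  rfl

theorem cotSub_eq_ker_projTan (V : Type*) [AddCommGroup V] [Module ℝ V] :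
    cotSub V = LinearMap.ker (projTan V) := by
  ext ⟨X, α⟩
  simp [cotSub, projTan]

theorem finrank_cotSub (V : Type*) [AddCommGroup V] [Module ℝ V] [FiniteDimensional ℝ V] :
    finrank ℝ (cotSub V) = finrank ℝ V := by
  have h : cotSub V = LinearMap.range (LinearMap.inr ℝ V (Module.Dual ℝ V)) := by
    rw [LinearMap.range_inr, cotSub_eq_ker_projTan, projTan]
  rw [h, LinearMap.finrank_range_of_inj LinearMap.inr_injective, Subspace.dual_finrank_eq]

/-- Rank-nullity for the projection `π` restricted to `E`. -/
theorem finrank_map_projTan_add_finrank_cotSub_inf {V : Type*} [AddCommGroup V] [Module ℝ V]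
    [FiniteDimensional ℝ V] (E : Submodule ℝ (V × Module.Dual ℝ V)) :
    finrank ℝ (E.map (projTan V)) + finrank ℝ ↥(cotSub V ⊓ E) = finrank ℝ E := by
  have h := LinearMap.finrank_range_add_finrank_ker (V := E) (V₂ := V)
    ((projTan V).domRestrict E)
  rw [LinearMap.range_domRestrict, LinearMap.ker_domRestrict, ← cotSub_eq_ker_projTan,
    ← Submodule.finrank_map_subtype_eq, Submodule.map_comap_subtype, inf_comm] at h
  exact h

/-- `V* ∩ E^⊥` is the annihilator of `π(E)`. -/
theorem cotSub_inf_orthogonal {V : Type*} [AddCommGroup V] [Module ℝ V]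
    (E : Submodule ℝ (V × Module.Dual ℝ V)) :
    cotSub V ⊓ (pairingForm V).orthogonal E =
      (E.map (projTan V)).dualAnnihilator.map (LinearMap.inr ℝ V (Module.Dual ℝ V)) := by
  ext ⟨X, α⟩
  simp only [cotSub, projTan, Submodule.mem_inf, Submodule.mem_prod, Submodule.mem_bot,
    Submodule.mem_top, and_true, LinearMap.BilinForm.mem_orthogonal_iff, Submodule.mem_map,
    pairingForm_apply, Submodule.mem_dualAnnihilator,
    LinearMap.inr_apply, Prod.mk.injEq]
  constructor
  · rintro ⟨rfl, h⟩
    refine ⟨α, ?_, rfl, rfl⟩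
    rintro _ ⟨w, hw, rfl⟩
    simpa using h w hw
  · rintro ⟨β, h, rfl, rfl⟩
    exact ⟨rfl, fun w hw => by simpa using h _ ⟨w, hw, rfl⟩⟩

theorem finrank_map_projTan_add_finrank_cotSub_inf_orthogonal {V : Type*} [AddCommGroup V]
    [Module ℝ V] [FiniteDimensional ℝ V] (E : Submodule ℝ (V × Module.Dual ℝ V)) :
    finrank ℝ (E.map (projTan V)) + finrank ℝ ↥(cotSub V ⊓ (pairingForm V).orthogonal E) =
      finrank ℝ V := by
  rw [cotSub_inf_orthogonal,
    ← (Submodule.equivMapOfInjective _ LinearMap.inr_injective _).finrank_eq]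
  exact Subspace.finrank_add_finrank_dualAnnihilator_eq _

theorem disjoint_orthogonal_of_isSplitOfRank {V : Type*} [AddCommGroup V] [Module ℝ V]
    {k : ℕ} {E : Submodule ℝ (V × Module.Dual ℝ V)} (hE : IsSplitOfRank k E) :
    Disjoint E ((pairingForm V).orthogonal E) := by
  rw [Submodule.disjoint_def]
  intro x hx hx'
  refine hE.2.1 x hx fun y hy => ?_
  have h := LinearMap.BilinForm.mem_orthogonal_iff.1 hx' y hy
  rw [pairingForm_apply] at h
  rw [pairingForm_apply, add_comm, h]

/-- Proposition 26, 1) ⇔ 2) (pointwise form): for a split subspace `E` of rank `2k`,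
`dim π(E) = k` if and only if `V* = (V* ∩ E) ⊕ (V* ∩ E^⊥)`. -/
theorem stmt7 {V : Type*} [AddCommGroup V] [Module ℝ V] [FiniteDimensional ℝ V]
    (k : ℕ) (E : Submodule ℝ (V × Module.Dual ℝ V)) (hE : IsSplitOfRank k E) :
    Module.finrank ℝ (E.map (projTan V)) = k ↔
      ((cotSub V ⊓ E) ⊔ (cotSub V ⊓ (pairingForm V).orthogonal E) = cotSub V ∧
        Disjoint (cotSub V ⊓ E) (cotSub V ⊓ (pairingForm V).orthogonal E)) := by
  have hdisj : Disjoint (cotSub V ⊓ E) (cotSub V ⊓ (pairingForm V).orthogonal E) :=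
    (disjoint_orthogonal_of_isSplitOfRank hE).mono inf_le_right inf_le_right
  have hrank := finrank_map_projTan_add_finrank_cotSub_inf E
  have hann := finrank_map_projTan_add_finrank_cotSub_inf_orthogonal E
  have hsum := Submodule.finrank_sup_add_finrank_inf_eq
    (cotSub V ⊓ E) (cotSub V ⊓ (pairingForm V).orthogonal E)
  rw [hdisj.eq_bot, finrank_bot] at hsum
  have hcot := finrank_cotSub V
  have hdim := hE.1
  rw [and_iff_left hdisj]
  constructor
  · intro h
    exact Submodule.eq_of_le_of_finrank_eq (sup_le inf_le_left inf_le_left) (by omega)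
  · intro h
    rw [h] at hsum
    omega
end

section
/- Let V be an n-dimensional real vector space, W = V × V* with the form ⟨(X,α),(Y,β)⟩ = α(Y) + β(X), and let E ⊆ W be split of rank 2k with orthogonal complement E^⊥. Then dim π(E) = k if and only if V = π(E) ⊕ π(E^⊥). -/
open Module

theorem pairingForm_apply_s8 {V : Type*} [AddCommGroup V] [Module ℝ V]
    (x y : V × Module.Dual ℝ V) : pairingForm V x y = x.2 y.1 + y.2 x.1 :=
  rfl

theorem pairingForm_isSymm (V : Type*) [AddCommGroup V] [Module ℝ V] :
    (pairingForm V).IsSymm :=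
  ⟨fun _ _ => add_comm _ _⟩

theorem pairingForm_nondegenerate (V : Type*) [AddCommGroup V] [Module ℝ V] :
    (pairingForm V).Nondegenerate := by
  have hleft : ∀ x, (∀ y, pairingForm V x y = 0) → x = 0 := by
    intro x hx
    refine Prod.ext ((Module.forall_dual_apply_eq_zero_iff ℝ x.1).1 fun φ => ?_)
      (LinearMap.ext fun v => ?_)
    · simpa [pairingForm_apply_s8] using hx (0, φ)
    · simpa [pairingForm_apply_s8] using hx (v, 0)
  exact ⟨hleft, fun y hy => hleft y fun x => ((pairingForm_isSymm V).eq y x).trans (hy x)⟩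

/-- Rank-nullity for the first projection restricted to a subspace of a product. -/
theorem finrank_map_fst_add_finrank_comap_inr {K V V' : Type*} [Field K]
    [AddCommGroup V] [Module K V] [AddCommGroup V'] [Module K V']
    [FiniteDimensional K V] [FiniteDimensional K V'] (E : Submodule K (V × V')) :
    finrank K (E.map (LinearMap.fst K V V')) + finrank K (E.comap (LinearMap.inr K V V')) =
      finrank K E := by
  have hker : (LinearMap.ker ((LinearMap.fst K V V').domRestrict E)).map E.subtype =
      (E.comap (LinearMap.inr K V V')).map (LinearMap.inr K V V') := by
    rw [LinearMap.ker_domRestrict, Submodule.map_comap_subtype, Submodule.map_comap_eq,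
      LinearMap.range_inr, inf_comm]
  rw [← LinearMap.finrank_range_add_finrank_ker ((LinearMap.fst K V V').domRestrict E),
    LinearMap.range_domRestrict, ← Submodule.finrank_map_subtype_eq E, hker,
    (Submodule.equivMapOfInjective (LinearMap.inr K V V') LinearMap.inr_injective _).finrank_eq]

/-- The annihilator of `π(E^⊥)` is `E ∩ V*`. -/
theorem dualAnnihilator_map_projTan_orthogonal {V : Type*} [AddCommGroup V] [Module ℝ V]
    [FiniteDimensional ℝ V] (E : Submodule ℝ (V × Module.Dual ℝ V)) :
    (((pairingForm V).orthogonal E).map (projTan V)).dualAnnihilator =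
      E.comap (LinearMap.inr ℝ V (Module.Dual ℝ V)) := by
  conv_rhs => rw [← LinearMap.BilinForm.orthogonal_orthogonal (pairingForm_nondegenerate V)
    (pairingForm_isSymm V).isRefl E]
  ext α
  rw [Submodule.mem_dualAnnihilator, Submodule.mem_comap,
    LinearMap.BilinForm.mem_orthogonal_iff]
  simp only [Submodule.mem_map, forall_exists_index, and_imp, forall_apply_eq_imp_iff₂]
  simp [pairingForm_apply_s8, projTan]

/-- Proposition 26, 1) ⇔ 3) (pointwise form): for a split subspace `E` of rank `2k`,
`dim π(E) = k` if and only if `V = π(E) ⊕ π(E^⊥)`. -/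
theorem stmt8 {V : Type*} [AddCommGroup V] [Module ℝ V] [FiniteDimensional ℝ V]
    (k : ℕ) (E : Submodule ℝ (V × Module.Dual ℝ V)) (hE : IsSplitOfRank k E) :
    Module.finrank ℝ (E.map (projTan V)) = k ↔
      (E.map (projTan V) ⊔ (((pairingForm V).orthogonal E).map (projTan V)) = ⊤ ∧
        Disjoint (E.map (projTan V)) (((pairingForm V).orthogonal E).map (projTan V))) := by
  obtain ⟨hrank, hnondeg, -⟩ := hE
  have hcompl : IsCompl E ((pairingForm V).orthogonal E) := by
    rw [LinearMap.BilinForm.isCompl_orthogonal_iff_disjoint (pairingForm_isSymm V).isRefl,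
      Submodule.disjoint_def]
    exact fun x hx hx' => hnondeg x hx fun y hy => ((pairingForm_isSymm V).eq x y).trans (hx' y hy)
  have hsup : E.map (projTan V) ⊔ ((pairingForm V).orthogonal E).map (projTan V) = ⊤ := by
    rw [← Submodule.map_sup, hcompl.sup_eq_top, Submodule.map_top]
    exact LinearMap.range_eq_top.2 LinearMap.fst_surjective
  have hE_dim : finrank ℝ (E.map (projTan V)) +
      finrank ℝ (E.comap (LinearMap.inr ℝ V (Module.Dual ℝ V))) = finrank ℝ E :=
    finrank_map_fst_add_finrank_comap_inr E
  have hann := Subspace.finrank_add_finrank_dualAnnihilator_eq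
    (((pairingForm V).orthogonal E).map (projTan V))
  rw [dualAnnihilator_map_projTan_orthogonal] at hann
  have hdim := Submodule.finrank_sup_add_finrank_inf_eq (E.map (projTan V))
    (((pairingForm V).orthogonal E).map (projTan V))
  rw [hsup, finrank_top] at hdim
  rw [and_iff_right hsup, disjoint_iff, ← Submodule.finrank_eq_zero (R := ℝ)]
  omega
end

section
/- Let V be an n-dimensional real vector space, W = V × V* with the form ⟨(X,α),(Y,β)⟩ = α(Y) + β(X), and let E ⊆ W be split of rank 2k with orthogonal complement E^⊥. Then dim π(E) = k if and only if dim π(E^⊥) = n − k. -/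
open Module

/-- The annihilator of `π(F)` is the intersection of `F^⊥` with `V*`. -/
theorem dualAnnihilator_map_projTan {V : Type*} [AddCommGroup V] [Module ℝ V]
    (F : Submodule ℝ (V × Module.Dual ℝ V)) :
    (F.map (projTan V)).dualAnnihilator =
      ((pairingForm V).orthogonal F).comap (LinearMap.inr ℝ V (Module.Dual ℝ V)) := by
  ext α
  simp [Submodule.mem_dualAnnihilator, LinearMap.BilinForm.mem_orthogonal_iff,
    pairingForm, projTan]

theorem finrank_map_projTan_add_finrank_comap_inr {V : Type*} [AddCommGroup V] [Module ℝ V]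
    [FiniteDimensional ℝ V] (E : Submodule ℝ (V × Module.Dual ℝ V)) :
    Module.finrank ℝ (E.map (projTan V)) +
      Module.finrank ℝ (E.comap (LinearMap.inr ℝ V (Module.Dual ℝ V))) =
        Module.finrank ℝ E := by
  have hker : (E.comap (LinearMap.inr ℝ V (Module.Dual ℝ V))).map
      (LinearMap.inr ℝ V (Module.Dual ℝ V)) =
        (LinearMap.ker ((projTan V).domRestrict E)).map E.subtype := by
    ext ⟨X, α⟩
    simp only [Submodule.mem_map, Submodule.mem_comap, LinearMap.mem_ker, projTan]
    constructor
    · rintro ⟨β, hβ, h⟩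
      exact ⟨⟨_, hβ⟩, by simp, h⟩
    · rintro ⟨⟨⟨Y, β⟩, hy⟩, h0, h⟩
      obtain rfl : Y = 0 := by simpa using h0
      exact ⟨β, hy, h⟩
  have hrn := LinearMap.finrank_range_add_finrank_ker (K := ℝ) (V := E)
    ((projTan V).domRestrict E)
  rwa [LinearMap.range_domRestrict,
    (Submodule.equivMapOfInjective E.subtype E.subtype_injective _).finrank_eq, ← hker,
    ← (Submodule.equivMapOfInjective _ LinearMap.inr_injective _).finrank_eq] at hrn

/-- `dim π(E^⊥)` and `dim (E ∩ V*)` add up to `dim V`. -/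
theorem finrank_map_projTan_orthogonal_add_finrank_comap_inr {V : Type*} [AddCommGroup V]
    [Module ℝ V] [FiniteDimensional ℝ V] (E : Submodule ℝ (V × Module.Dual ℝ V)) :
    Module.finrank ℝ (((pairingForm V).orthogonal E).map (projTan V)) +
      Module.finrank ℝ (E.comap (LinearMap.inr ℝ V (Module.Dual ℝ V))) =
        Module.finrank ℝ V := by
  rw [← Subspace.finrank_add_finrank_dualAnnihilator_eq
      (((pairingForm V).orthogonal E).map (projTan V)), dualAnnihilator_map_projTan,
    LinearMap.BilinForm.orthogonal_orthogonal (pairingForm_nondegenerate V)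
      (pairingForm_isSymm V).isRefl]

/-- Corollary 27 of the paper (pointwise form): for a split subspace `E` of rank `2k`
in `V × V*` with `dim V = n`, `dim π(E) = k` if and only if `dim π(E^⊥) = n - k`. -/
theorem stmt10 {V : Type*} [AddCommGroup V] [Module ℝ V] [FiniteDimensional ℝ V]
    (n k : ℕ) (hn : Module.finrank ℝ V = n)
    (E : Submodule ℝ (V × Module.Dual ℝ V)) (hE : IsSplitOfRank k E) :
    Module.finrank ℝ (E.map (projTan V)) = k ↔
      Module.finrank ℝ ((((pairingForm V).orthogonal E)).map (projTan V)) = n - k := by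
  have hmap := finrank_map_projTan_add_finrank_comap_inr E
  have horth := finrank_map_projTan_orthogonal_add_finrank_comap_inr E
  have hle := Submodule.finrank_le E
  rw [Module.finrank_prod, Subspace.dual_finrank_eq] at hle
  have hrank := hE.1
  omega
end
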